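/- Let A be an m×n matrix, B an n×p matrix, and C a p×q matrix over 𝔼, all three non-negative (every entry α satisfies 0 ≤ α, i.e. some x ∈ α has x ≥ 0). Then (AB)C = A(BC). -/

import Mathlib

open scoped Pointwise Classical

noncomputable section

-- Note: `ℝ*` is Mathlib's notation for the hyperreals `Hyperreal`.

/-- A neutrix: an order-convex additive subgroup of the hyperreals. -/
def IsNeutrix (A : Set ℝ*) : Prop :=
  (0 : ℝ*) ∈ A ∧ (∀ x ∈ A, ∀ y ∈ A, x + y ∈ A) ∧ (∀ x ∈ A, -x ∈ A) ∧
    ∀ x ∈ A, ∀ y ∈ A, ∀ z : ℝ*, x ≤ z → z ≤ y → z ∈ A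

/-- The coset `a + A`. -/
def coset (a : ℝ*) (A : Set ℝ*) : Set ℝ* := {x | ∃ u ∈ A, x = a + u}

/-- `α` is an external number: a coset of a neutrix. -/
def IsExt (α : Set ℝ*) : Prop := ∃ a A, IsNeutrix A ∧ α = coset a A

/-- The neutrix part `N(α)` of an external number, as the set of differences. -/
def Nx (α : Set ℝ*) : Set ℝ* := {d | ∃ x ∈ α, ∃ y ∈ α, d = x - y}

/-- An external number is zeroless if it does not contain `0`. -/
def Zeroless (α : Set ℝ*) : Prop := (0 : ℝ*) ∉ α

/-- Multiplication of external numbers: `αβ = ab + aB + bA + AB`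
(independent of the chosen representatives). -/
def emul (α β : Set ℝ*) : Set ℝ* :=
  {z | ∃ a A b B, IsNeutrix A ∧ IsNeutrix B ∧ α = coset a A ∧ β = coset b B ∧
      ∃ u ∈ A, ∃ v ∈ B, ∃ u' ∈ A, ∃ v' ∈ B, z = a * b + a * v + b * u + u' * v'}

/-- Multiplication of an external number by a hyperreal scalar: `t·α = ta + tA`. -/
def esmul (t : ℝ*) (α : Set ℝ*) : Set ℝ* := (fun x => t * x) '' α

/-- Inverse of a (zeroless) external number: `1/α = 1/a + A/a²`. -/
def einv (α : Set ℝ*) : Set ℝ* :=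
  {z | ∃ a A, IsNeutrix A ∧ α = coset a A ∧ ∃ u ∈ A, z = a⁻¹ + u / a ^ 2}

/-- Division of external numbers: `α/β = α · (1/β)`. -/
def ediv (α β : Set ℝ*) : Set ℝ* := emul α (einv β)

/-- The neutrix `⊘` of infinitesimal hyperreals. -/
def oslash : Set ℝ* := {x | Hyperreal.Infinitesimal x}

/-- Relative uncertainty `R(α)`: `A/a` if `α = a + A` is zeroless,
and all of `ℝ*` if `α` is a neutrix. -/
def RU (α : Set ℝ*) : Set ℝ* :=
  if (0 : ℝ*) ∈ α then Set.univ
  else {z | ∃ a A, IsNeutrix A ∧ α = coset a A ∧ ∃ u ∈ A, z = u / a}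

/-- `α` and `β` are nearly opposite: both zeroless and `α/β ⊆ -1 + ⊘`. -/
def NearlyOpposite (α β : Set ℝ*) : Prop :=
  Zeroless α ∧ Zeroless β ∧ ediv α β ⊆ coset (-1) oslash

/-- Order on external numbers: `α ≤ β` iff `∀ x ∈ α, ∃ y ∈ β, x ≤ y`. -/
def ele (α β : Set ℝ*) : Prop := ∀ x ∈ α, ∃ y ∈ β, x ≤ y

/-- `α` is non-negative: some element of `α` is `≥ 0`. -/
def eNonneg (α : Set ℝ*) : Prop := ∃ x ∈ α, (0 : ℝ*) ≤ x

/-- Absolute value of an external number: `|α| = |a| + A`. -/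
def eabs (α : Set ℝ*) : Set ℝ* :=
  {z | ∃ a A, IsNeutrix A ∧ α = coset a A ∧ ∃ u ∈ A, z = |a| + u}

/-- Product of a finite family of external numbers. -/
def eprod : ∀ {n : ℕ}, (Fin n → Set ℝ*) → Set ℝ*
  | 0, _ => {1}
  | _ + 1, f => emul (f 0) (eprod fun i => f i.succ)

/-- Power of an external number. -/
def epow (α : Set ℝ*) : ℕ → Set ℝ*
  | 0 => {1}
  | k + 1 => emul α (epow α k)

/-- Matrix product over external numbers: `(AB)_{ij} = Σ_k α_{ik}β_{kj}`. -/
def matMul {m n p : ℕ} (M : Matrix (Fin m) (Fin n) (Set ℝ*))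
    (N : Matrix (Fin n) (Fin p) (Set ℝ*)) : Matrix (Fin m) (Fin p) (Set ℝ*) :=
  fun i j => ∑ k, emul (M i k) (N k j)

/-- Entrywise (Minkowski) sum of matrices over external numbers. -/
def matAdd {m n : ℕ} (M N : Matrix (Fin m) (Fin n) (Set ℝ*)) :
    Matrix (Fin m) (Fin n) (Set ℝ*) := fun i j => M i j + N i j

/-- Entrywise scalar multiple of a matrix by an external number. -/
def matSmul {m n : ℕ} (α : Set ℝ*) (M : Matrix (Fin m) (Fin n) (Set ℝ*)) :
    Matrix (Fin m) (Fin n) (Set ℝ*) := fun i j => emul α (M i j)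

/-- Entrywise inclusion of matrices over external numbers. -/
def matIncl {m n : ℕ} (M N : Matrix (Fin m) (Fin n) (Set ℝ*)) : Prop :=
  ∀ i j, M i j ⊆ N i j

/-- Determinant of a square matrix over the external numbers. -/
def detE {n : ℕ} (M : Matrix (Fin n) (Fin n) (Set ℝ*)) : Set ℝ* :=
  ∑ σ : Equiv.Perm (Fin n),
    esmul ((Equiv.Perm.sign σ : ℤ) : ℝ*) (eprod fun i => M i (σ i))

/-- The `(i,j)` minor of a square matrix over the external numbers. -/
def minorE {n : ℕ} (M : Matrix (Fin (n + 1)) (Fin (n + 1)) (Set ℝ*))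
    (i j : Fin (n + 1)) : Set ℝ* :=
  detE (M.submatrix i.succAbove j.succAbove)

/-- The near-identity matrix `I_n(N)`: diagonal entries `1 + N`, off-diagonal entries `N`. -/
def Iun (n : ℕ) (N : Set ℝ*) : Matrix (Fin n) (Fin n) (Set ℝ*) :=
  fun i j => if i = j then coset 1 N else N

/-- A finite family of vectors of external numbers is linearly dependent:
some nontrivial real (hyperreal) linear combination is a neutrix vector. -/
def LinDepE {ι : Type*} [Fintype ι] {n : ℕ} (ξ : ι → Fin n → Set ℝ*) : Prop :=
  ∃ t : ι → ℝ*, (∃ i, t i ≠ 0) ∧ ∃ A : Fin n → Set ℝ*,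
    (∀ j, IsNeutrix (A j)) ∧ ∀ j, (∑ i, esmul (t i) (ξ i j)) = A j

/-- The matrix has a zeroless minor of order `k`. -/
def HasZerolessMinor {m n : ℕ} (M : Matrix (Fin m) (Fin n) (Set ℝ*)) (k : ℕ) : Prop :=
  ∃ (f : Fin k → Fin m) (g : Fin k → Fin n), Function.Injective f ∧ Function.Injective g ∧
    Zeroless (detE fun i j => M (f i) (g j))

/-- The minor rank of `M` is `r`. -/
def minorRankIs {m n : ℕ} (M : Matrix (Fin m) (Fin n) (Set ℝ*)) (r : ℕ) : Prop :=
  HasZerolessMinor M r ∧ ∀ k, HasZerolessMinor M k → k ≤ r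

/-- The row rank of `M` is `r`: the maximal cardinality of a linearly
independent set of row vectors of `M` is `r`. -/
def rowRankIs {m n : ℕ} (M : Matrix (Fin m) (Fin n) (Set ℝ*)) (r : ℕ) : Prop :=
  (∃ s : Finset (Fin m), s.card = r ∧ ¬ LinDepE fun (i : {x // x ∈ s}) j => M i.1 j) ∧
  ∀ s : Finset (Fin m), (¬ LinDepE fun (i : {x // x ∈ s}) j => M i.1 j) → s.card ≤ r

/-- `M` is a reduced matrix: `max_{i,j} |α_{ij}| = 1 + A₀` for some neutrix `A₀ ⊆ ⊘`. -/
def IsReducedMat {m n : ℕ} (M : Matrix (Fin m) (Fin n) (Set ℝ*)) : Prop :=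
  ∃ A₀, IsNeutrix A₀ ∧ A₀ ⊆ oslash ∧ (∃ i j, eabs (M i j) = coset 1 A₀) ∧
    ∀ i j, ele (eabs (M i j)) (coset 1 A₀)

namespace IsNeutrix

variable {A B : Set ℝ*}

lemma mem_of_abs_le (hA : IsNeutrix A) {u z : ℝ*} (hu : u ∈ A) (hz : |z| ≤ u) : z ∈ A :=
  hA.2.2.2 (-u) (hA.2.2.1 u hu) u hu z (abs_le.1 hz).1 (abs_le.1 hz).2

lemma abs_mem (hA : IsNeutrix A) {u : ℝ*} (hu : u ∈ A) : |u| ∈ A := by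
  rcases abs_choice u with h | h <;> rw [h]
  exacts [hu, hA.2.2.1 u hu]

lemma mul_mem (hA : IsNeutrix A) {t u : ℝ*} (hu : u ∈ A) (ht : |t| ≤ 1) : t * u ∈ A :=
  hA.mem_of_abs_le (hA.abs_mem hu) <| by
    rw [abs_mul]
    exact mul_le_of_le_one_left (abs_nonneg u) ht

/-- A subset of the hyperreals which contains `0`, is solid, and in which sums of absolute values
stay, is a neutrix. -/
lemma of_solid (h0 : (0 : ℝ*) ∈ A) (hadd : ∀ x ∈ A, ∀ y ∈ A, |x| + |y| ∈ A)
    (hsolid : ∀ x ∈ A, ∀ z : ℝ*, |z| ≤ |x| → z ∈ A) : IsNeutrix A := by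
  refine ⟨h0, fun x hx y hy => ?_, fun x hx => hsolid x hx _ (abs_neg x).le,
    fun x hx y hy z hxz hzy => ?_⟩
  · exact hsolid _ (hadd x hx y hy) _ ((abs_add_le x y).trans (le_abs_self _))
  · refine hsolid _ (hadd x hx y hy) _ (le_trans (abs_le.2 ⟨?_, ?_⟩) (le_abs_self _))
    · linarith [neg_abs_le x, abs_nonneg y]
    · linarith [le_abs_self y, abs_nonneg x]

end IsNeutrix

/-- A number dominated by a nonnegative one is its multiple by a factor in `[-1, 1]`. -/
lemma exists_eq_mul_of_abs_le {d r : ℝ*} (h : |d| ≤ r) : ∃ t : ℝ*, |t| ≤ 1 ∧ d = t * r := by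
  rcases eq_or_ne r 0 with rfl | hr
  · exact ⟨0, by simp, by simpa using h⟩
  · refine ⟨d / r, ?_, (div_mul_cancel₀ d hr).symm⟩
    rw [abs_div]
    exact div_le_one_of_le₀ (h.trans (le_abs_self r)) (abs_nonneg r)

lemma mem_coset {a z : ℝ*} {A : Set ℝ*} : z ∈ coset a A ↔ z - a ∈ A := by
  constructor
  · rintro ⟨u, hu, rfl⟩
    simpa using hu
  · exact fun h => ⟨z - a, h, by ring⟩

lemma IsNeutrix.coset_inj {A A' : Set ℝ*} (hA : IsNeutrix A) (hA' : IsNeutrix A') {a a' : ℝ*}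
    (h : coset a A = coset a' A') : A = A' ∧ a' - a ∈ A := by
  have mem_iff : ∀ z, z - a ∈ A ↔ z - a' ∈ A' := fun z => by
    rw [← mem_coset, h, mem_coset]
  have h1 : a' - a ∈ A := (mem_iff a').2 (by simpa using hA'.1)
  refine ⟨Set.ext fun x => ?_, h1⟩
  have h2 := mem_iff (x + a')
  rw [add_sub_cancel_right] at h2
  rw [← h2]
  constructor
  · intro hx
    simpa [add_sub_assoc] using hA.2.1 x hx _ h1
  · intro hx
    have := hA.2.1 _ hx _ (hA.2.2.1 _ h1)
    rwa [show x + a' - a + -(a' - a) = x by ring] at this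

lemma mem_add_iff_abs_le {A B : Set ℝ*} (hA : IsNeutrix A) (hB : IsNeutrix B) {d : ℝ*} :
    d ∈ A + B ↔ ∃ u ∈ A, ∃ v ∈ B, 0 ≤ u ∧ 0 ≤ v ∧ |d| ≤ u + v := by
  constructor
  · rintro ⟨u, hu, v, hv, rfl⟩
    exact ⟨|u|, hA.abs_mem hu, |v|, hB.abs_mem hv, abs_nonneg u, abs_nonneg v, abs_add_le u v⟩
  · rintro ⟨u, hu, v, hv, -, -, h⟩
    obtain ⟨t, ht, rfl⟩ := exists_eq_mul_of_abs_le h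
    exact ⟨t * u, hA.mul_mem hu ht, t * v, hB.mul_mem hv ht, (mul_add t u v).symm⟩

lemma IsNeutrix.add {A B : Set ℝ*} (hA : IsNeutrix A) (hB : IsNeutrix B) :
    IsNeutrix (A + B) := by
  refine IsNeutrix.of_solid ⟨0, hA.1, 0, hB.1, add_zero 0⟩ ?_ ?_ <;>
    simp only [mem_add_iff_abs_le hA hB]
  · rintro x ⟨u, hu, v, hv, hu0, hv0, h⟩ y ⟨u', hu', v', hv', hu0', hv0', h'⟩
    refine ⟨u + u', hA.2.1 _ hu _ hu', v + v', hB.2.1 _ hv _ hv', add_nonneg hu0 hu0',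
      add_nonneg hv0 hv0', ?_⟩
    rw [abs_of_nonneg (by positivity)]
    linarith
  · rintro x ⟨u, hu, v, hv, hu0, hv0, h⟩ z hz
    exact ⟨u, hu, v, hv, hu0, hv0, hz.trans h⟩

lemma coset_add_coset (a b : ℝ*) (A B : Set ℝ*) :
    coset a A + coset b B = coset (a + b) (A + B) := by
  ext z
  constructor
  · rintro ⟨_, ⟨u, hu, rfl⟩, _, ⟨v, hv, rfl⟩, rfl⟩
    exact ⟨u + v, ⟨u, hu, v, hv, rfl⟩, add_add_add_comm a u b v⟩
  · rintro ⟨_, ⟨u, hu, v, hv, rfl⟩, rfl⟩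
    exact ⟨a + u, ⟨u, hu, rfl⟩, b + v, ⟨v, hv, rfl⟩, add_add_add_comm a u b v⟩

/-- The neutrix part `aB + bA + AB` of the product of `a + A` and `b + B`, for `a, b ≥ 0`. -/
def mulNeutrix (a : ℝ*) (A : Set ℝ*) (b : ℝ*) (B : Set ℝ*) : Set ℝ* :=
  {d | ∃ u ∈ A, ∃ v ∈ B, 0 ≤ u ∧ 0 ≤ v ∧ |d| ≤ a * v + b * u + u * v}

lemma IsNeutrix.mulNeutrix {A B : Set ℝ*} (hA : IsNeutrix A) (hB : IsNeutrix B) (a b : ℝ*) :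
    IsNeutrix (mulNeutrix a A b B) := by
  refine IsNeutrix.of_solid ⟨0, hA.1, 0, hB.1, le_rfl, le_rfl, by simp⟩ ?_ ?_
  · rintro x ⟨u, hu, v, hv, hu0, hv0, h⟩ y ⟨u', hu', v', hv', hu0', hv0', h'⟩
    refine ⟨u + u', hA.2.1 _ hu _ hu', v + v', hB.2.1 _ hv _ hv', add_nonneg hu0 hu0',
      add_nonneg hv0 hv0', ?_⟩
    rw [abs_of_nonneg (by positivity)]
    linarith [mul_nonneg hu0 hv0', mul_nonneg hu0' hv0]
  · rintro x ⟨u, hu, v, hv, hu0, hv0, h⟩ z hz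
    exact ⟨u, hu, v, hv, hu0, hv0, hz.trans h⟩

lemma emul_coset {A B : Set ℝ*} (hA : IsNeutrix A) (hB : IsNeutrix B) {a b : ℝ*}
    (ha : 0 ≤ a) (hb : 0 ≤ b) :
    emul (coset a A) (coset b B) = coset (a * b) (mulNeutrix a A b B) := by
  ext z
  rw [mem_coset]
  constructor
  · rintro ⟨a', A', b', B', hA', hB', hα, hβ, u, hu, v, hv, u', hu', v', hv', rfl⟩
    obtain ⟨rfl, hs⟩ := hA.coset_inj hA' hα
    obtain ⟨rfl, ht⟩ := hB.coset_inj hB' hβ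
    obtain ⟨s, rfl⟩ : ∃ s, a' = a + s := ⟨a' - a, by ring⟩
    obtain ⟨t, rfl⟩ : ∃ t, b' = b + t := ⟨b' - b, by ring⟩
    rw [add_sub_cancel_left] at hs ht
    refine ⟨|s| + |u| + |u'|, hA.2.1 _ (hA.2.1 _ (hA.abs_mem hs) _ (hA.abs_mem hu)) _
      (hA.abs_mem hu'), |t| + |v| + |v'|, hB.2.1 _ (hB.2.1 _ (hB.abs_mem ht) _ (hB.abs_mem hv)) _
      (hB.abs_mem hv'), by positivity, by positivity, ?_⟩
    have bound : ∀ x y : ℝ*, x * y ≤ |x| * |y| ∧ -(x * y) ≤ |x| * |y| := fun x y => by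
      rw [← abs_mul]
      exact ⟨le_abs_self _, neg_le_abs _⟩
    have bound_left : ∀ {c : ℝ*}, 0 ≤ c → ∀ x, c * x ≤ c * |x| ∧ -(c * x) ≤ c * |x| :=
      fun {c} hc x => by simpa [abs_of_nonneg hc] using bound c x
    have nn : ∀ x y : ℝ*, 0 ≤ |x| * |y| := fun x y => by positivity
    have nn_left : ∀ {c : ℝ*}, 0 ≤ c → ∀ x, 0 ≤ c * |x| := fun hc x => by positivity
    rw [abs_le]
    constructor <;>
    linarith [bound s t, bound s v, bound t u, bound u' v', bound_left ha t, bound_left ha v,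
      bound_left hb s, bound_left hb u, nn_left ha v', nn_left hb u', nn s v', nn u v, nn u v',
      nn u' t, nn u' v]
  · rintro ⟨u, hu, v, hv, -, -, h⟩
    obtain ⟨t, ht, h⟩ := exists_eq_mul_of_abs_le h
    refine ⟨a, A, b, B, hA, hB, rfl, rfl, t * u, hA.mul_mem hu ht, t * v, hB.mul_mem hv ht,
      t * u, hA.mul_mem hu ht, v, hv, ?_⟩
    linear_combination h

lemma emul_comm (α β : Set ℝ*) : emul α β = emul β α := by
  have sub : ∀ α β, emul α β ⊆ emul β α := by
    rintro α β _ ⟨a, A, b, B, hA, hB, hα, hβ, u, hu, v, hv, u', hu', v', hv', rfl⟩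
    exact ⟨b, B, a, A, hB, hA, hβ, hα, v, hv, u, hu, v', hv', u', hu', by ring⟩
  exact (sub α β).antisymm (sub β α)

/-- Non-negative external numbers, through a non-negative representative. -/
def IsNonnegExt (α : Set ℝ*) : Prop := ∃ a A, 0 ≤ a ∧ IsNeutrix A ∧ α = coset a A

lemma IsExt.isNonnegExt {α : Set ℝ*} (h : IsExt α) (h0 : eNonneg α) : IsNonnegExt α := by
  obtain ⟨a, A, hA, rfl⟩ := h
  obtain ⟨_, ⟨u, hu, rfl⟩, h0⟩ := h0
  refine ⟨a + u, A, h0, hA, Set.ext fun z => ?_⟩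
  rw [mem_coset, mem_coset]
  constructor <;> intro hz
  · rw [sub_add_eq_sub_sub, sub_eq_add_neg _ u]
    exact hA.2.1 _ hz _ (hA.2.2.1 _ hu)
  · simpa [sub_add_eq_sub_sub] using hA.2.1 _ hz _ hu

lemma isNeutrix_zero : IsNeutrix (0 : Set ℝ*) := by
  refine IsNeutrix.of_solid rfl ?_ ?_ <;> simp

lemma zero_eq_coset : (0 : Set ℝ*) = coset 0 0 := by
  ext z
  simp [mem_coset]

lemma isNonnegExt_zero : IsNonnegExt 0 := ⟨0, 0, le_rfl, isNeutrix_zero, zero_eq_coset⟩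

namespace IsNonnegExt

variable {α β γ : Set ℝ*}

lemma add (hα : IsNonnegExt α) (hβ : IsNonnegExt β) : IsNonnegExt (α + β) := by
  obtain ⟨a, A, ha, hA, rfl⟩ := hα
  obtain ⟨b, B, hb, hB, rfl⟩ := hβ
  exact ⟨a + b, A + B, add_nonneg ha hb, hA.add hB, coset_add_coset a b A B⟩

lemma emul (hα : IsNonnegExt α) (hβ : IsNonnegExt β) : IsNonnegExt (emul α β) := by
  obtain ⟨a, A, ha, hA, rfl⟩ := hα
  obtain ⟨b, B, hb, hB, rfl⟩ := hβ
  exact ⟨a * b, _, mul_nonneg ha hb, hA.mulNeutrix hB a b, emul_coset hA hB ha hb⟩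

lemma sum {ι : Type*} {s : Finset ι} {f : ι → Set ℝ*} (hf : ∀ i ∈ s, IsNonnegExt (f i)) :
    IsNonnegExt (∑ i ∈ s, f i) :=
  Finset.sum_induction f IsNonnegExt (fun _ _ => add) isNonnegExt_zero hf

lemma emul_zero (hα : IsNonnegExt α) : _root_.emul α 0 = 0 := by
  obtain ⟨a, A, ha, hA, rfl⟩ := hα
  rw [zero_eq_coset, emul_coset hA isNeutrix_zero ha le_rfl, mul_zero]
  congr 1
  ext d
  constructor
  · rintro ⟨u, -, v, hv, -, -, h⟩
    obtain rfl : v = 0 := hv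
    simpa using h
  · intro hd
    obtain rfl : d = 0 := hd
    exact ((hA.mulNeutrix isNeutrix_zero a 0)).1

lemma emul_add (hα : IsNonnegExt α) (hβ : IsNonnegExt β) (hγ : IsNonnegExt γ) :
    _root_.emul α (β + γ) = _root_.emul α β + _root_.emul α γ := by
  obtain ⟨a, A, ha, hA, rfl⟩ := hα
  obtain ⟨b, B, hb, hB, rfl⟩ := hβ
  obtain ⟨c, C, hc, hC, rfl⟩ := hγ
  rw [coset_add_coset, emul_coset hA (hB.add hC) ha (add_nonneg hb hc), emul_coset hA hB ha hb,
    emul_coset hA hC ha hc, coset_add_coset, mul_add]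
  congr 1
  ext d
  rw [mem_add_iff_abs_le (hA.mulNeutrix hB a b) (hA.mulNeutrix hC a c)]
  constructor
  · rintro ⟨u, hu, _, ⟨v, hv, w, hw, rfl⟩, hu0, -, h⟩
    have hr : 0 ≤ a * |v| + b * u + u * |v| := by positivity
    have hs : 0 ≤ a * |w| + c * u + u * |w| := by positivity
    refine ⟨_, ⟨u, hu, |v|, hB.abs_mem hv, hu0, abs_nonneg v, (abs_of_nonneg hr).le⟩,
      _, ⟨u, hu, |w|, hC.abs_mem hw, hu0, abs_nonneg w, (abs_of_nonneg hs).le⟩, hr, hs, ?_⟩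
    have h1 := mul_le_mul_of_nonneg_left (le_abs_self v) (add_nonneg ha hu0)
    have h2 := mul_le_mul_of_nonneg_left (le_abs_self w) (add_nonneg ha hu0)
    simp only at h
    linarith
  · rintro ⟨r, ⟨u, hu, v, hv, hu0, hv0, hr⟩, s, ⟨u', hu', w, hw, hu0', hw0, hs⟩, hr0, hs0, h⟩
    refine ⟨u + u', hA.2.1 _ hu _ hu', v + w, ⟨v, hv, w, hw, rfl⟩, add_nonneg hu0 hu0',
      add_nonneg hv0 hw0, ?_⟩
    rw [abs_of_nonneg hr0] at hr
    rw [abs_of_nonneg hs0] at hs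
    linarith [mul_nonneg hb hu0', mul_nonneg hc hu0, mul_nonneg hu0 hw0, mul_nonneg hu0' hv0]

lemma add_emul (hα : IsNonnegExt α) (hβ : IsNonnegExt β) (hγ : IsNonnegExt γ) :
    _root_.emul (α + β) γ = _root_.emul α γ + _root_.emul β γ := by
  rw [emul_comm, hγ.emul_add hα hβ, emul_comm γ, emul_comm γ]

lemma emul_sum {ι : Type*} {s : Finset ι} {f : ι → Set ℝ*} (hα : IsNonnegExt α)
    (hf : ∀ i, IsNonnegExt (f i)) :
    _root_.emul α (∑ i ∈ s, f i) = ∑ i ∈ s, _root_.emul α (f i) := by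
  induction s using Finset.induction_on with
  | empty => simpa using hα.emul_zero
  | insert i s hi ih =>
    rw [Finset.sum_insert hi, Finset.sum_insert hi,
      hα.emul_add (hf i) (sum fun j _ => hf j), ih]

lemma sum_emul {ι : Type*} {s : Finset ι} {f : ι → Set ℝ*} (hα : IsNonnegExt α)
    (hf : ∀ i, IsNonnegExt (f i)) :
    _root_.emul (∑ i ∈ s, f i) α = ∑ i ∈ s, _root_.emul (f i) α := by
  simp only [emul_comm _ α, hα.emul_sum hf]

end IsNonnegExt

/-- Iterated products of non-negative external numbers, described symmetrically. -/
lemma mem_emul_emul_coset {A B C : Set ℝ*} (hA : IsNeutrix A) (hB : IsNeutrix B)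
    (hC : IsNeutrix C) {a b c : ℝ*} (ha : 0 ≤ a) (hb : 0 ≤ b) (hc : 0 ≤ c) {z : ℝ*} :
    z ∈ emul (emul (coset a A) (coset b B)) (coset c C) ↔
      ∃ u ∈ A, ∃ v ∈ B, ∃ w ∈ C, 0 ≤ u ∧ 0 ≤ v ∧ 0 ≤ w ∧
        |z - a * b * c| ≤ (a + u) * (b + v) * (c + w) - a * b * c := by
  rw [emul_coset hA hB ha hb, emul_coset (hA.mulNeutrix hB a b) hC (mul_nonneg ha hb) hc,
    mem_coset]
  constructor
  · rintro ⟨r, ⟨u, hu, v, hv, hu0, hv0, hr⟩, w, hw, hr0, hw0, h⟩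
    refine ⟨u, hu, v, hv, w, hw, hu0, hv0, hw0, h.trans ?_⟩
    rw [abs_of_nonneg hr0] at hr
    linarith [mul_le_mul_of_nonneg_right hr (add_nonneg hc hw0)]
  · rintro ⟨u, hu, v, hv, w, hw, hu0, hv0, hw0, h⟩
    have hr : 0 ≤ a * v + b * u + u * v := by positivity
    refine ⟨_, ⟨u, hu, v, hv, hu0, hv0, (abs_of_nonneg hr).le⟩, w, hw, hr, hw0, h.trans_eq ?_⟩
    ring

lemma IsNonnegExt.emul_assoc {α β γ : Set ℝ*} (hα : IsNonnegExt α) (hβ : IsNonnegExt β)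
    (hγ : IsNonnegExt γ) :
    _root_.emul (_root_.emul α β) γ = _root_.emul α (_root_.emul β γ) := by
  obtain ⟨a, A, ha, hA, rfl⟩ := hα
  obtain ⟨b, B, hb, hB, rfl⟩ := hβ
  obtain ⟨c, C, hc, hC, rfl⟩ := hγ
  ext z
  rw [emul_comm (coset a A) (_root_.emul _ _), mem_emul_emul_coset hA hB hC ha hb hc,
    mem_emul_emul_coset hB hC hA hb hc ha, show b * c * a = a * b * c by ring]
  constructor
  · rintro ⟨u, hu, v, hv, w, hw, hu0, hv0, hw0, h⟩
    exact ⟨v, hv, w, hw, u, hu, hv0, hw0, hu0, h.trans_eq (by ring)⟩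
  · rintro ⟨v, hv, w, hw, u, hu, hv0, hw0, hu0, h⟩
    exact ⟨u, hu, v, hv, w, hw, hu0, hv0, hw0, h.trans_eq (by ring)⟩

theorem stmt6 {m n p q : ℕ} (A : Matrix (Fin m) (Fin n) (Set ℝ*))
    (B : Matrix (Fin n) (Fin p) (Set ℝ*)) (C : Matrix (Fin p) (Fin q) (Set ℝ*))
    (hA : ∀ i j, IsExt (A i j)) (hB : ∀ i j, IsExt (B i j)) (hC : ∀ i j, IsExt (C i j))
    (hA' : ∀ i j, eNonneg (A i j)) (hB' : ∀ i j, eNonneg (B i j))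
    (hC' : ∀ i j, eNonneg (C i j)) :
    matMul (matMul A B) C = matMul A (matMul B C) := by
  have hA'' := fun i j => (hA i j).isNonnegExt (hA' i j)
  have hB'' := fun i j => (hB i j).isNonnegExt (hB' i j)
  have hC'' := fun i j => (hC i j).isNonnegExt (hC' i j)
  ext1 i j
  calc ∑ l, emul (∑ k, emul (A i k) (B k l)) (C l j)
      = ∑ l, ∑ k, emul (emul (A i k) (B k l)) (C l j) := by
        refine Finset.sum_congr rfl fun l _ => ?_
        exact (hC'' l j).sum_emul fun k => (hA'' i k).emul (hB'' k l)
    _ = ∑ k, ∑ l, emul (A i k) (emul (B k l) (C l j)) := by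
        rw [Finset.sum_comm]
        simp only [(hA'' _ _).emul_assoc (hB'' _ _) (hC'' _ _)]
    _ = ∑ k, emul (A i k) (∑ l, emul (B k l) (C l j)) := by
        refine Finset.sum_congr rfl fun k _ => ?_
        exact ((hA'' i k).emul_sum fun l => (hB'' k l).emul (hC'' l j)).symm
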